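/- arXiv:1203.0905 — 3 statements merged into one kernel-verified Lean document; each statement's English description precedes it below -/
import Mathlib

section
/- The determinant of a 4×4 matrix, viewed as a polynomial in the 16 entries, is irreducible over any field. -/
open MvPolynomial in
/-- Grading homomorphism: multiplies the variable `s` by `T ^ w s`. -/
noncomputable def gradeHom {σ K : Type*} [Field K] (w : σ → ℕ) :
    MvPolynomial σ K →ₐ[K] Polynomial (MvPolynomial σ K) :=
  MvPolynomial.aeval (fun s => Polynomial.C (MvPolynomial.X s) * Polynomial.X ^ w s)

theorem gradeHom_monomial {σ K : Type*} [Field K] (w : σ → ℕ) (d : σ →₀ ℕ) (c : K) :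
    gradeHom w (MvPolynomial.monomial d c) =
      Polynomial.monomial (Finsupp.weight w d) (MvPolynomial.monomial d c) := by
  rw [gradeHom, MvPolynomial.aeval_monomial]
  rw [← Polynomial.C_mul_X_pow_eq_monomial, MvPolynomial.monomial_eq (a := c)]
  simp only [Finsupp.prod, mul_pow, Finset.prod_mul_distrib, ← pow_mul, Finset.prod_pow_eq_pow_sum,
    Finsupp.weight_apply, Finsupp.sum, smul_eq_mul, map_mul, map_prod, map_pow]
  rw [mul_assoc]
  congr 3
  exact Finset.sum_congr rfl fun _ _ => mul_comm _ _

theorem coeff_gradeHom {σ K : Type*} [Field K] (w : σ → ℕ) (p : MvPolynomial σ K)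
    (d : σ →₀ ℕ) :
    MvPolynomial.coeff d ((gradeHom w p).coeff (Finsupp.weight w d)) = MvPolynomial.coeff d p := by
  classical
  induction p using MvPolynomial.induction_on' with
  | monomial e b =>
    rw [gradeHom_monomial, Polynomial.coeff_monomial]
    split_ifs with h
    · rfl
    · rw [MvPolynomial.coeff_monomial, if_neg]
      · simp
      · rintro rfl; exact h rfl
  | add p q hp hq =>
    rw [map_add, Polynomial.coeff_add, MvPolynomial.coeff_add, MvPolynomial.coeff_add, hp, hq]

theorem gradeHom_ne_zero {σ K : Type*} [Field K] (w : σ → ℕ) {p : MvPolynomial σ K}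
    (hp : p ≠ 0) : gradeHom w p ≠ 0 := by
  intro h
  apply hp
  ext d
  rw [← coeff_gradeHom w, h]
  simp

theorem notMem_vars_of_gradeHom {σ K : Type*} [Field K] (w : σ → ℕ) {p : MvPolynomial σ K}
    (h : (gradeHom w p).natDegree = 0) {s : σ} (hs : w s ≠ 0) : s ∉ p.vars := by
  intro hv
  obtain ⟨d, hd, hsd⟩ := MvPolynomial.mem_vars_iff_mem_support s |>.1 hv
  rw [MvPolynomial.mem_support_iff, ← coeff_gradeHom w] at hd
  have h1 : Finsupp.weight w d ≤ 0 := by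
    rw [← h]
    apply Polynomial.le_natDegree_of_ne_zero
    intro h0
    rw [h0] at hd
    simp at hd
  have h2 := Finsupp.le_weight_of_ne_zero' w (s := s) (f := d) (Finsupp.mem_support_iff.1 hsd)
  omega

open Matrix in
theorem natDegree_row {n K : Type*} [Fintype n] [DecidableEq n] [Field K] (i : n) :
    (gradeHom (fun s : n × n => if s.1 = i then 1 else 0)
      (det (mvPolynomialX n n K))).natDegree = 1 := by
  rw [AlgHom.map_det]
  have : (gradeHom (fun s : n × n => if s.1 = i then 1 else 0)).mapMatrix (mvPolynomialX n n K)
      = of fun a b => (if a = i then Polynomial.X else 1) *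
        ((Polynomial.C : _ →+* Polynomial (MvPolynomial (n × n) K)).mapMatrix
          (mvPolynomialX n n K)) a b := by
    ext1 a b
    by_cases h : a = i <;> simp [gradeHom, h]
  rw [this, det_mul_column, ← RingHom.map_det]
  simp [det_mvPolynomialX_ne_zero]

open Matrix in
theorem natDegree_col {n K : Type*} [Fintype n] [DecidableEq n] [Field K] (i : n) :
    (gradeHom (fun s : n × n => if s.2 = i then 1 else 0)
      (det (mvPolynomialX n n K))).natDegree = 1 := by
  rw [AlgHom.map_det]
  have : (gradeHom (fun s : n × n => if s.2 = i then 1 else 0)).mapMatrix (mvPolynomialX n n K)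
      = of fun a b => (if b = i then Polynomial.X else 1) *
        ((Polynomial.C : _ →+* Polynomial (MvPolynomial (n × n) K)).mapMatrix
          (mvPolynomialX n n K)) a b := by
    ext1 a b
    by_cases h : b = i <;> simp [gradeHom, h]
  rw [this, det_mul_row, ← RingHom.map_det]
  simp [det_mvPolynomialX_ne_zero]

open Matrix in
/-- Every variable occurs in the determinant. -/
theorem mem_vars_det {n K : Type*} [Fintype n] [DecidableEq n] [Field K] (i j : n) :
    (i, j) ∈ (det (mvPolynomialX n n K)).vars := by
  by_contra hv
  let M : Matrix n n K := (Equiv.swap i j).permMatrix K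
  let s : n × n → K := fun p => M p.1 p.2
  let s' : n × n → K := fun p => if p = (i, j) then 0 else M p.1 p.2
  have h : MvPolynomial.eval s (det (mvPolynomialX n n K))
      = MvPolynomial.eval s' (det (mvPolynomialX n n K)) := by
    refine MvPolynomial.eval₂Hom_congr' rfl ?_ rfl
    intro a ha _
    have : a ≠ (i, j) := by rintro rfl; exact hv ha
    simp [s, s', this]
  rw [eval_det_mvPolynomialX, eval_det_mvPolynomialX] at h
  have h0 : det (of fun a b => s' (a, b)) = 0 := by
    apply det_eq_zero_of_row_eq_zero i
    intro b
    by_cases hb : b = j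
    · simp [s', hb]
    · simp [s', hb, M, Equiv.Perm.permMatrix, PEquiv.toMatrix_apply, Ne.symm hb]
  have h1 : det (of fun a b => s (a, b)) = ((Equiv.Perm.sign (Equiv.swap i j) : ℤ) : K) :=
    det_permutation _
  rw [h0, h1] at h
  rcases Int.units_eq_one_or (Equiv.Perm.sign (Equiv.swap i j)) with e | e <;> simp [e] at h

open Matrix in
theorem isUnit_of_row {n K : Type*} [Fintype n] [DecidableEq n] [Field K] (i : n)
    {P Q : MvPolynomial (n × n) K} (h : det (mvPolynomialX n n K) = P * Q)
    (hQ : (gradeHom (fun s : n × n => if s.1 = i then 1 else 0) Q).natDegree = 0) :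
    IsUnit Q := by
  have hne := det_mvPolynomialX_ne_zero n K
  rw [h] at hne
  obtain ⟨hP0, hQ0⟩ := mul_ne_zero_iff.1 hne
  have key : ∀ j, (gradeHom (fun s : n × n => if s.2 = j then 1 else 0) Q).natDegree = 0 := by
    intro j
    by_contra hj
    have h1 := natDegree_col (K := K) j
    rw [h, map_mul, Polynomial.natDegree_mul (gradeHom_ne_zero _ hP0) (gradeHom_ne_zero _ hQ0)]
      at h1
    have hP : (i, j) ∉ P.vars := notMem_vars_of_gradeHom
      (fun s : n × n => if s.2 = j then 1 else 0) (by omega) (by simp)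
    have hQ' : (i, j) ∉ Q.vars := notMem_vars_of_gradeHom _ hQ (by simp)
    have := mem_vars_det (K := K) i j
    rw [h] at this
    rcases Finset.mem_union.1 (MvPolynomial.vars_mul P Q this) with h' | h'
    · exact hP h'
    · exact hQ' h'
  have hv : Q.vars = ∅ := by
    ext ⟨a, b⟩
    simpa using notMem_vars_of_gradeHom _ (key b) (s := (a, b)) (by simp)
  obtain ⟨c, rfl⟩ : ∃ c, Q = MvPolynomial.C c :=
    ⟨_, MvPolynomial.vars_eq_empty_iff_eq_C.1 hv⟩
  exact (IsUnit.mk0 c (by rintro rfl; simp at hQ0)).map MvPolynomial.C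

/-- The determinant of a 4×4 matrix, viewed as a polynomial in the 16 entries,
is irreducible over any field. -/
theorem stmt13 (K : Type*) [Field K] :
    Irreducible (Matrix.det (Matrix.mvPolynomialX (Fin 4) (Fin 4) K)) := by
  have hne := Matrix.det_mvPolynomialX_ne_zero (Fin 4) K
  refine ⟨fun hu => ?_, fun P Q h => ?_⟩
  · have h1 := natDegree_row (K := K) (0 : Fin 4)
    have h2 := Polynomial.natDegree_eq_zero_of_isUnit
      (hu.map (gradeHom (fun s : Fin 4 × Fin 4 => if s.1 = 0 then 1 else 0)))
    omega
  · have h1 := natDegree_row (K := K) (0 : Fin 4)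
    have hne' := hne
    rw [h] at hne'
    obtain ⟨hP0, hQ0⟩ := mul_ne_zero_iff.1 hne'
    rw [h, map_mul, Polynomial.natDegree_mul (gradeHom_ne_zero _ hP0) (gradeHom_ne_zero _ hQ0)]
      at h1
    rcases Nat.eq_zero_or_pos ((gradeHom (fun s : Fin 4 × Fin 4 => if s.1 = 0 then 1 else 0)
      Q).natDegree) with hq | hq
    · exact Or.inr (isUnit_of_row 0 h hq)
    · exact Or.inl (isUnit_of_row 0 (h.trans (mul_comm P Q)) (by omega))
end

section
/- The polynomial D(π, a₁,…,a₄) = det(ν₂(L₁π),…,ν₂(L₆π), ν₂(a₁),…,ν₂(a₄)) vanishes whenever the plane π passes through one of the points aⱼ (i.e., π^T aⱼ = 0 for some j); hence each linear form π^T aⱼ divides D as a polynomial in π. -/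
open Matrix MvPolynomial

/-- The degree-2 Veronese map on R⁴. -/
def nu2four {R : Type*} [CommRing R] (x : Fin 4 → R) : Fin 10 → R :=
  ![x 0 ^ 2, x 0 * x 1, x 0 * x 2, x 0 * x 3, x 1 ^ 2,
    x 1 * x 2, x 1 * x 3, x 2 ^ 2, x 2 * x 3, x 3 ^ 2]

/-- Variables: the coordinates of the plane π and of the four points a₁,…,a₄. -/
abbrev SLCVVars : Type := (Fin 4) ⊕ (Fin 4 × Fin 4)

/-- The coordinates of π as polynomial variables. -/
noncomputable def piVar : Fin 4 → MvPolynomial SLCVVars ℂ := fun i => X (Sum.inl i)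

/-- The coordinates of the point aⱼ as polynomial variables. -/
noncomputable def aVar : Fin 4 → Fin 4 → MvPolynomial SLCVVars ℂ :=
  fun j i => X (Sum.inr (j, i))

/-- The polynomial D(π,a₁,…,a₄) = det(ν₂(L₁π),…,ν₂(L₆π),ν₂(a₁),…,ν₂(a₄)),
seen as a polynomial in the coordinates of π and of the aⱼ. -/
noncomputable def Dpoly (L : Fin 6 → Matrix (Fin 4) (Fin 4) ℂ) :
    MvPolynomial SLCVVars ℂ :=
  Matrix.det (Matrix.of fun r c : Fin 10 =>
    Fin.append (fun i : Fin 6 => nu2four (((L i).map MvPolynomial.C).mulVec piVar))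
      (fun j : Fin 4 => nu2four (aVar j)) c r)

/-- The coefficients of the quadric `(p ⬝ x) (c ⬝ x)` in the Veronese coordinates. -/
def quadCoeff {R : Type*} [CommRing R] (p c : Fin 4 → R) : Fin 10 → R :=
  ![p 0 * c 0, p 0 * c 1 + p 1 * c 0, p 0 * c 2 + p 2 * c 0, p 0 * c 3 + p 3 * c 0, p 1 * c 1,
    p 1 * c 2 + p 2 * c 1, p 1 * c 3 + p 3 * c 1, p 2 * c 2, p 2 * c 3 + p 3 * c 2, p 3 * c 3]

lemma quadCoeff_dot {R : Type*} [CommRing R] (p c x : Fin 4 → R) :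
    quadCoeff p c ⬝ᵥ nu2four x = (p ⬝ᵥ x) * (c ⬝ᵥ x) := by
  simp [quadCoeff, nu2four, dotProduct, Fin.sum_univ_succ, Fin.succ]
  ring

lemma skew_dot (L : Matrix (Fin 4) (Fin 4) ℂ) (hL : Lᵀ = -L) :
    piVar ⬝ᵥ ((L.map MvPolynomial.C).mulVec piVar) = 0 := by
  have h1 : (L.map (MvPolynomial.C (σ := SLCVVars)))ᵀ = -(L.map MvPolynomial.C) := by
    rw [← Matrix.transpose_map, hL]
    ext i j
    simp
  have h2 : piVar ⬝ᵥ ((L.map MvPolynomial.C).mulVec piVar)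
      = - (piVar ⬝ᵥ ((L.map MvPolynomial.C).mulVec piVar)) := by
    conv_lhs => rw [Matrix.dotProduct_mulVec, ← Matrix.mulVec_transpose, h1, Matrix.neg_mulVec,
      neg_dotProduct, dotProduct_comm]
  exact self_eq_neg.mp h2

lemma irr_form (j : Fin 4) :
    Irreducible (∑ i : Fin 4, piVar i * aVar j i) := by
  have e : (∑ i : Fin 4, piVar i * aVar j i) = aVar j 0 * X (Sum.inl 0) +
      (piVar 1 * aVar j 1 + piVar 2 * aVar j 2 + piVar 3 * aVar j 3) := by
    simp [Fin.sum_univ_succ, piVar, Fin.succ]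
    ring
  rw [e]
  apply irreducible_mul_X_add
  · exact X_ne_zero _
  · simp [aVar]
  · intro h
    simp only [piVar, aVar] at h
    classical
    rcases Finset.mem_union.mp (vars_add_subset _ _ h) with h | h
    · rcases Finset.mem_union.mp (vars_add_subset _ _ h) with h | h
      · simpa using vars_mul _ _ h
      · simpa using vars_mul _ _ h
    · simpa using vars_mul _ _ h
  · have hp : Prime (aVar j 0) := X_prime
    rw [hp.irreducible.isRelPrime_iff_not_dvd]
    rintro ⟨q, hq⟩
    have := congrArg (MvPolynomial.eval (Sum.elim (fun _ => 1)
      (fun p : Fin 4 × Fin 4 => if p.2 = 1 then (1 : ℂ) else 0))) hq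
    simp [piVar, aVar] at this

/-- The matrix of the points. -/
noncomputable def aMat : Matrix (Fin 4) (Fin 4) (MvPolynomial SLCVVars ℂ) := Matrix.of aVar

lemma not_dvd_form (j : Fin 4) :
    ¬ (∑ i : Fin 4, piVar i * aVar j i) ∣ piVar 0 * aMat.adjugate 0 j := by
  rintro ⟨q, hq⟩
  let v : SLCVVars → ℂ := Sum.elim (Pi.single 0 1)
      (fun p : Fin 4 × Fin 4 => if p.1 = j then 0 else if Equiv.swap 0 j p.1 = p.2 then 1 else 0)
  have h := congrArg (MvPolynomial.eval v) hq
  have h0 : MvPolynomial.eval v (∑ i : Fin 4, piVar i * aVar j i) = 0 := by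
    simp [piVar, aVar, v]
  have h1 : MvPolynomial.eval v (aMat.adjugate 0 j)
      = Matrix.det ((Equiv.swap 0 j).permMatrix ℂ) := by
    rw [Matrix.adjugate_apply, RingHom.map_det]
    congr 1
    ext r c
    by_cases hr : r = j
    · subst hr
      simp [Matrix.updateRow_apply, Pi.single_apply, PEquiv.toMatrix_apply, eq_comm]
    · simp [Matrix.updateRow_apply, hr, aMat, aVar, v, PEquiv.toMatrix_apply, eq_comm]
      exact fun h => absurd h.symm hr
  rw [map_mul, map_mul, h0, h1, zero_mul, Matrix.det_permutation] at h
  have h2 : MvPolynomial.eval v (piVar 0) = 1 := by simp [piVar, v]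
  rw [h2, one_mul] at h
  rcases Int.units_eq_one_or (Equiv.Perm.sign (Equiv.swap 0 j)) with h3 | h3 <;>
    simp [h3] at h

lemma form_dvd (L : Fin 6 → Matrix (Fin 4) (Fin 4) ℂ) (hL : ∀ i, (L i)ᵀ = -(L i)) (j : Fin 4) :
    (∑ i : Fin 4, piVar i * aVar j i) ∣ Dpoly L := by
  have hp : Prime (∑ i : Fin 4, piVar i * aVar j i) := (irr_form j).prime
  let c : Fin 4 → MvPolynomial SLCVVars ℂ := fun i => aMat.adjugate i j
  let M : Matrix (Fin 10) (Fin 10) (MvPolynomial SLCVVars ℂ) := Matrix.of fun r c : Fin 10 =>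
    Fin.append (fun i : Fin 6 => nu2four (((L i).map MvPolynomial.C).mulVec piVar))
      (fun j : Fin 4 => nu2four (aVar j)) c r
  have hD : Dpoly L = M.det := rfl
  have hc : ∀ k, k ≠ j → c ⬝ᵥ aVar k = 0 := by
    intro k hk
    have := congrFun (congrFun (Matrix.mul_adjugate aMat) k) j
    rw [Matrix.mul_apply] at this
    rw [dotProduct_comm]
    simpa [hk, aMat, c, dotProduct] using this
  have hw : ∀ k, (∑ i : Fin 4, piVar i * aVar j i) ∣ Matrix.vecMul (quadCoeff piVar c) M k := by
    intro k
    change _ ∣ quadCoeff piVar c ⬝ᵥ (Fin.append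
      (fun i : Fin 6 => nu2four (((L i).map MvPolynomial.C).mulVec piVar))
      (fun j : Fin 4 => nu2four (aVar j)) k)
    refine Fin.addCases (m := 6) (n := 4) (fun i => ?_) (fun i => ?_) k
    · rw [Fin.append_left, quadCoeff_dot, skew_dot _ (hL i), zero_mul]
      exact dvd_zero _
    · rw [Fin.append_right, quadCoeff_dot]
      by_cases hij : i = j
      · subst hij
        exact Dvd.intro _ rfl
      · rw [hc i hij, mul_zero]
        exact dvd_zero _
  have h1 : Matrix.vecMul (Matrix.vecMul (quadCoeff piVar c) M) M.adjugate 0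
      = M.det * (piVar 0 * c 0) := by
    rw [Matrix.vecMul_vecMul, Matrix.mul_adjugate, Matrix.vecMul_smul, Matrix.vecMul_one]
    simp [quadCoeff]
  have h2 : (∑ i : Fin 4, piVar i * aVar j i) ∣ M.det * (piVar 0 * c 0) := by
    rw [← h1]
    simp only [Matrix.vecMul, dotProduct] at hw ⊢
    exact Finset.dvd_sum fun k _ => (hw k).mul_right _
  rw [hD]
  exact (hp.dvd_or_dvd h2).resolve_right (not_dvd_form j)

/-- D vanishes whenever the plane π passes through one of the points aⱼ; hence
each linear form πᵀaⱼ divides D. -/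
theorem stmt14 (L : Fin 6 → Matrix (Fin 4) (Fin 4) ℂ)
    (hL : ∀ i, (L i)ᵀ = -(L i) ∧ (L i).rank = 2) :
    (∀ (π : Fin 4 → ℂ) (a : Fin 4 → Fin 4 → ℂ), (∃ j, π ⬝ᵥ a j = 0) →
        MvPolynomial.eval (Sum.elim π fun p => a p.1 p.2) (Dpoly L) = 0) ∧
      (∀ j : Fin 4, (∑ i : Fin 4, piVar i * aVar j i) ∣ Dpoly L) := by
  refine ⟨?_, fun j => form_dvd L (fun i => (hL i).1) j⟩
  rintro π a ⟨j, hj⟩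
  obtain ⟨q, hq⟩ := form_dvd L (fun i => (hL i).1) j
  have h0 : MvPolynomial.eval (Sum.elim π fun p : Fin 4 × Fin 4 => a p.1 p.2)
      (∑ i : Fin 4, piVar i * aVar j i) = 0 := by
    simpa [piVar, aVar, dotProduct] using hj
  rw [hq, map_mul, h0, zero_mul]
end

section
/- (Result 2 of the paper, factorization.) There exists a polynomial F(π), homogeneous of degree 8 in the coordinates of π and independent of a₁,…,a₄, such that det(ν₂(L₁π),…,ν₂(L₆π), ν₂(a₁),…,ν₂(a₄)) = det(a₁,…,a₄)·(π^T a₁)(π^T a₂)(π^T a₃)(π^T a₄)·F(π); moreover the planes intersecting the six lines in points of a conic are exactly the zeros of F. -/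
open Matrix MvPolynomial

/-- The plane π meets the six lines Lᵢ in points of a conic contained in π. -/
def MeetsInConic (L : Fin 6 → Matrix (Fin 4) (Fin 4) ℂ) (π : Fin 4 → ℂ) : Prop :=
  ∃ Q : Matrix (Fin 4) (Fin 4) ℂ, Qᵀ = Q ∧
    (¬ ∀ x : Fin 4 → ℂ, π ⬝ᵥ x = 0 → x ⬝ᵥ Q.mulVec x = 0) ∧
    ∀ i : Fin 6, ((L i).mulVec π) ⬝ᵥ Q.mulVec ((L i).mulVec π) = 0

/-- Monomials of degree two in the last three coordinates. -/
def nu2three {R : Type*} [CommRing R] (x : Fin 4 → R) : Fin 6 → R :=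
  ![x 1 ^ 2, x 1 * x 2, x 1 * x 3, x 2 ^ 2, x 2 * x 3, x 3 ^ 2]

/-- Row operations: the first four rows represent the quadrics `(π·x) x_k`. -/
def rowOps {R : Type*} [CommRing R] (p : Fin 4 → R) : Matrix (Fin 10) (Fin 10) R :=
  !![p 0, p 1, p 2, p 3, 0, 0, 0, 0, 0, 0;
     0, p 0, 0, 0, p 1, p 2, p 3, 0, 0, 0;
     0, 0, p 0, 0, 0, p 1, 0, p 2, p 3, 0;
     0, 0, 0, p 0, 0, 0, p 1, 0, p 2, p 3;
     0, 0, 0, 0, 1, 0, 0, 0, 0, 0;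
     0, 0, 0, 0, 0, 1, 0, 0, 0, 0;
     0, 0, 0, 0, 0, 0, 1, 0, 0, 0;
     0, 0, 0, 0, 0, 0, 0, 1, 0, 0;
     0, 0, 0, 0, 0, 0, 0, 0, 1, 0;
     0, 0, 0, 0, 0, 0, 0, 0, 0, 1]

theorem rowOps_det {R : Type*} [CommRing R] (p : Fin 4 → R) :
    (rowOps p).det = p 0 ^ 4 := by
  rw [Matrix.det_of_isUpperTriangular]
  · simp [rowOps, Fin.prod_univ_succ]; ring
  · intro i j h
    fin_cases i <;> fin_cases j <;> first | rfl | (exfalso; revert h; decide)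

theorem rowOps_top {R : Type*} [CommRing R] (p x : Fin 4 → R) (k : Fin 4) :
    (rowOps p *ᵥ nu2four x) (Fin.castAdd 6 k) = (∑ i, p i * x i) * x k := by
  fin_cases k <;>
    simp [rowOps, nu2four, Matrix.mulVec, dotProduct, Fin.sum_univ_succ] <;> ring

theorem rowOps_bot {R : Type*} [CommRing R] (p x : Fin 4 → R) (k : Fin 6) :
    (rowOps p *ᵥ nu2four x) (Fin.natAdd 4 k) = nu2three x k := by
  fin_cases k <;>
    simp [rowOps, nu2four, nu2three, Matrix.mulVec, dotProduct, Fin.sum_univ_succ]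

/-- the shift by four on ten letters -/
def shiftFour : Equiv.Perm (Fin 10) := finRotate 10 ^ 6

theorem append_shift {α : Type*} (u : Fin 6 → α) (v : Fin 4 → α) (c : Fin 10) :
    (Fin.append u v : Fin 10 → α) (shiftFour c) = (Fin.append v u : Fin 10 → α) c := by
  fin_cases c <;> rfl

theorem sign_shift : Equiv.Perm.sign shiftFour = 1 := by
  simp [shiftFour, sign_finRotate]; decide

theorem key_identity {R : Type*} [CommRing R] (p : Fin 4 → R) (a : Fin 4 → Fin 4 → R)
    (q : Fin 6 → Fin 4 → R) (hq : ∀ i, ∑ k, p k * q i k = 0) :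
    p 0 ^ 4 * (Matrix.of fun r c : Fin 10 =>
      Fin.append (fun i : Fin 6 => nu2four (q i)) (fun j : Fin 4 => nu2four (a j)) c r).det
    = (Matrix.of fun r c : Fin 6 => nu2three (q c) r).det *
      ((Matrix.of fun i j : Fin 4 => a j i).det * ∏ j, ∑ i, p i * a j i) := by
  set M : Matrix (Fin 10) (Fin 10) R := Matrix.of fun r c : Fin 10 =>
      Fin.append (fun i : Fin 6 => nu2four (q i)) (fun j : Fin 4 => nu2four (a j)) c r with hM
  have h1 : (M.submatrix id shiftFour).det = M.det := by
    rw [Matrix.det_permute', sign_shift]; simp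
  set B : Matrix (Fin 4 ⊕ Fin 6) (Fin 4 ⊕ Fin 6) R :=
    (rowOps p * M.submatrix id shiftFour).submatrix finSumFinEquiv finSumFinEquiv with hB
  have entry : ∀ r c, (rowOps p * M.submatrix id shiftFour) r c =
      (rowOps p *ᵥ (Fin.append (fun j : Fin 4 => nu2four (a j))
        (fun i : Fin 6 => nu2four (q i)) c)) r := by
    intro r c
    simp only [Matrix.mul_apply, Matrix.mulVec, dotProduct, hM, Matrix.submatrix_apply,
      Matrix.of_apply, id]
    refine Finset.sum_congr rfl fun s _ => ?_
    rw [append_shift]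
  have hBb : B = Matrix.fromBlocks
      (Matrix.of fun i j : Fin 4 => (∑ k, p k * a j k) * a j i) 0
      (Matrix.of fun (i : Fin 6) (j : Fin 4) => nu2three (a j) i)
      (Matrix.of fun r c : Fin 6 => nu2three (q c) r) := by
    ext r c
    rcases r with r | r <;> rcases c with c | c <;>
      simp only [hB, Matrix.submatrix_apply, finSumFinEquiv_apply_left,
        finSumFinEquiv_apply_right] <;> erw [entry]
    · rw [Fin.append_left]; exact rowOps_top _ _ _
    · rw [Fin.append_right]; refine (rowOps_top _ _ _).trans ?_
      simp [hq]
    · rw [Fin.append_left]; exact rowOps_bot _ _ _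
    · rw [Fin.append_right]; exact rowOps_bot _ _ _
  have hdet : B.det = p 0 ^ 4 * M.det := by
    rw [hB, Matrix.det_submatrix_equiv_self]
    refine (Matrix.det_mul _ _).trans ?_
    rw [rowOps_det, h1]
  rw [← hdet, hBb, Matrix.det_fromBlocks_zero₁₂]
  have := Matrix.det_mul_row (fun j => ∑ k, p k * a j k) (Matrix.of fun i j : Fin 4 => a j i)
  simp only [Matrix.of_apply] at this
  rw [this]; ring

theorem antisymm_dot {R : Type*} [CommRing R] (L : Matrix (Fin 4) (Fin 4) ℂ) (hL : Lᵀ = -L)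
    (f : ℂ →+* R) (p : Fin 4 → R) : ∑ k, p k * ((L.map f).mulVec p) k = 0 := by
  have h : ∀ i j, L j i = - L i j := fun i j => congrFun (congrFun hL i) j
  have hd : ∀ i, L i i = 0 := fun i => by
    have := h i i
    linear_combination this / 2
  simp only [Matrix.mulVec, dotProduct, Fin.sum_univ_four, Matrix.map_apply, hd, h 0 1, h 0 2,
    h 0 3, h 1 2, h 1 3, h 2 3, map_neg, map_zero]
  ring

theorem nu2three_map {R S : Type*} [CommRing R] [CommRing S] (f : R →+* S) (x : Fin 4 → R)
    (k : Fin 6) : f (nu2three x k) = nu2three (fun i => f (x i)) k := by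
  fin_cases k <;> simp [nu2three]

theorem nu2four_map {R S : Type*} [CommRing R] [CommRing S] (f : R →+* S) (x : Fin 4 → R)
    (k : Fin 10) : f (nu2four x k) = nu2four (fun i => f (x i)) k := by
  fin_cases k <;> simp [nu2four]

/-- The 6×6 determinant in the coordinates 1,2,3. -/
noncomputable def detG (L : Fin 6 → Matrix (Fin 4) (Fin 4) ℂ) : MvPolynomial (Fin 4) ℂ :=
  (Matrix.of fun r c : Fin 6 =>
    nu2three (((L c).map (C : ℂ →+* MvPolynomial (Fin 4) ℂ)).mulVec X) r).det

theorem detG_hom (L : Fin 6 → Matrix (Fin 4) (Fin 4) ℂ) : (detG L).IsHomogeneous 12 := by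
  have hlin : ∀ c i, ((((L c).map (C : ℂ →+* MvPolynomial (Fin 4) ℂ)).mulVec X) i).IsHomogeneous 1 := by
    intro c i
    refine IsHomogeneous.sum _ _ _ fun j _ => ?_
    exact isHomogeneous_C_mul_X _ _
  have hent : ∀ r c, (nu2three (((L c).map (C : ℂ →+* MvPolynomial (Fin 4) ℂ)).mulVec X) r).IsHomogeneous 2 := by
    intro r c
    have h2 := fun i j => (hlin c i).mul (hlin c j)
    fin_cases r <;> simp only [nu2three, pow_two] <;> exact h2 _ _
  rw [detG, Matrix.det_apply]
  refine IsHomogeneous.sum _ _ _ fun σ _ => ?_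
  have hp : (∏ i, (Matrix.of fun r c : Fin 6 =>
    nu2three (((L c).map (C : ℂ →+* MvPolynomial (Fin 4) ℂ)).mulVec X) r) (σ i) i).IsHomogeneous 12 := by
    have := IsHomogeneous.prod Finset.univ (fun i => (Matrix.of fun r c : Fin 6 =>
      nu2three (((L c).map (C : ℂ →+* MvPolynomial (Fin 4) ℂ)).mulVec X) r) (σ i) i) (fun _ => 2)
      (fun i _ => hent _ _)
    simpa using this
  rcases Int.units_eq_one_or (Equiv.Perm.sign σ) with h | h <;> rw [h]
  · simpa using hp
  · simpa using hp.neg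

theorem detG_factor (L : Fin 6 → Matrix (Fin 4) (Fin 4) ℂ) (hL : ∀ i, (L i)ᵀ = -(L i)) :
    ∃ F : MvPolynomial (Fin 4) ℂ, F.IsHomogeneous 8 ∧ detG L = X 0 ^ 4 * F := by
  let A : Matrix (Fin 4) (Fin 4) ℂ := !![1, 1, 0, 0; 0, 1, 0, 0; 0, 0, 1, 0; 0, 0, 0, 1]
  have key := key_identity (X : Fin 4 → MvPolynomial (Fin 4) ℂ) (fun j i => C (A j i))
    (fun i => ((L i).map C).mulVec X) (fun i => antisymm_dot (L i) (hL i) C X)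
  have hdvd : (X 0 : MvPolynomial (Fin 4) ℂ) ^ 4 ∣ detG L := by
    refine (X_prime (i := (0 : Fin 4)) (R := ℂ)).pow_dvd_of_dvd_mul_right 4 ?_ ⟨_, key.symm⟩
    rintro ⟨g, hg⟩
    have h := congrArg (eval (![0, 1, 1, 1] : Fin 4 → ℂ)) hg
    have hdet : (Matrix.of fun i j : Fin 4 => (C (A j i) : MvPolynomial (Fin 4) ℂ)).det = C A.det := by
      rw [← Matrix.det_transpose A, RingHom.map_det]; rfl
    have hA : A.det = 1 := by
      simp [A, Matrix.det_succ_row_zero, Fin.sum_univ_succ, Fin.succAbove]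
    rw [hdet, hA] at h
    simp [A, Fin.prod_univ_succ, Fin.sum_univ_succ] at h
  obtain ⟨F, hF⟩ := hdvd
  refine ⟨F, ?_, hF⟩
  intro d hd
  have hh := detG_hom L
  have hc : coeff (Finsupp.single 0 4 + d) (detG L) ≠ 0 := by
    rw [hF, X_pow_eq_monomial, coeff_monomial_mul]; simpa using hd
  have := hh hc
  simp only [map_add, Finsupp.weight_single] at this
  simp at this
  omega

theorem Dpoly_factor (L : Fin 6 → Matrix (Fin 4) (Fin 4) ℂ) (hL : ∀ i, (L i)ᵀ = -(L i))
    (F : MvPolynomial (Fin 4) ℂ) (hF : detG L = X 0 ^ 4 * F) :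
    Dpoly L = Matrix.det (Matrix.of fun i j : Fin 4 => aVar j i)
          * (∏ j : Fin 4, ∑ i : Fin 4, piVar i * aVar j i)
          * MvPolynomial.rename Sum.inl F := by
  have key := key_identity piVar aVar
    (fun i => ((L i).map C).mulVec piVar) (fun i => antisymm_dot (L i) (hL i) C piVar)
  have hG : (Matrix.of fun r c : Fin 6 => nu2three (((L c).map C).mulVec piVar) r).det
      = rename Sum.inl (detG L) := by
    have : (rename (Sum.inl : Fin 4 → SLCVVars) (detG L) : MvPolynomial SLCVVars ℂ)
      = (rename (R := ℂ) (Sum.inl : Fin 4 → SLCVVars)).toRingHom (detG L) := rfl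
    rw [this, detG, RingHom.map_det]
    congr 1
    ext1 r c
    simp only [Matrix.of_apply, RingHom.mapMatrix_apply, Matrix.map_apply]
    rw [nu2three_map]
    congr 1
    funext i
    simp [Matrix.mulVec, dotProduct, piVar]
  rw [hG, hF] at key
  simp only [map_mul, map_pow, rename_X] at key
  have hX : (piVar 0) ^ 4 ≠ 0 := pow_ne_zero _ (X_ne_zero _)
  apply mul_left_cancel₀ hX
  refine key.trans ?_
  simp only [piVar]
  ring

theorem eval_D (L : Fin 6 → Matrix (Fin 4) (Fin 4) ℂ) (F : MvPolynomial (Fin 4) ℂ)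
    (h : Dpoly L = Matrix.det (Matrix.of fun i j : Fin 4 => aVar j i)
          * (∏ j : Fin 4, ∑ i : Fin 4, piVar i * aVar j i)
          * MvPolynomial.rename Sum.inl F) (π : Fin 4 → ℂ) (A : Matrix (Fin 4) (Fin 4) ℂ) :
    (Matrix.of fun r c : Fin 10 =>
      Fin.append (fun i : Fin 6 => nu2four ((L i).mulVec π)) (fun j : Fin 4 => nu2four (A j)) c r).det
    = A.det * (∏ j, π ⬝ᵥ A j) * eval π F := by
  have h := congrArg (eval (Sum.elim π (fun x => A x.1 x.2))) h
  rw [Dpoly, RingHom.map_det, map_mul, map_mul, RingHom.map_det, eval_rename] at h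
  rw [← Matrix.det_transpose A]
  convert h using 1
  · congr 1
    ext1 r c
    simp only [RingHom.mapMatrix_apply, Matrix.map_apply, Matrix.of_apply]
    refine Fin.addCases (m := 6) (n := 4) (fun i => ?_) (fun j => ?_) c
    · erw [Fin.append_left, Fin.append_left, nu2four_map]
      congr 1
      funext i
      simp [Matrix.mulVec, dotProduct, piVar]
    · erw [Fin.append_right, Fin.append_right, nu2four_map]
      congr 1
      funext i
      simp [aVar]
  · congr 2
    · congr 1
      ext i j
      simp [aVar]
    · simp [aVar, piVar, dotProduct]

/-- The coefficient vector of the quadratic form of `Q`. -/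
def coeffVec (Q : Matrix (Fin 4) (Fin 4) ℂ) : Fin 10 → ℂ :=
  ![Q 0 0, Q 0 1 + Q 1 0, Q 0 2 + Q 2 0, Q 0 3 + Q 3 0, Q 1 1,
    Q 1 2 + Q 2 1, Q 1 3 + Q 3 1, Q 2 2, Q 2 3 + Q 3 2, Q 3 3]

theorem coeffVec_dot (Q : Matrix (Fin 4) (Fin 4) ℂ) (x : Fin 4 → ℂ) :
    coeffVec Q ⬝ᵥ nu2four x = x ⬝ᵥ Q.mulVec x := by
  simp [coeffVec, nu2four, Matrix.mulVec, dotProduct, Fin.sum_univ_succ]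
  ring

/-- The symmetric matrix of the quadratic form with given coefficients. -/
noncomputable def symMat (v : Fin 10 → ℂ) : Matrix (Fin 4) (Fin 4) ℂ :=
  !![v 0, v 1 / 2, v 2 / 2, v 3 / 2; v 1 / 2, v 4, v 5 / 2, v 6 / 2;
     v 2 / 2, v 5 / 2, v 7, v 8 / 2; v 3 / 2, v 6 / 2, v 8 / 2, v 9]

theorem symMat_symm (v : Fin 10 → ℂ) : (symMat v)ᵀ = symMat v := by
  ext i j; fin_cases i <;> fin_cases j <;> rfl

theorem coeffVec_symMat (v : Fin 10 → ℂ) : coeffVec (symMat v) = v := by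
  funext i; fin_cases i <;> simp [coeffVec, symMat]

theorem coeffVec_zero_of (Q : Matrix (Fin 4) (Fin 4) ℂ)
    (h : ∀ x : Fin 4 → ℂ, x ⬝ᵥ Q.mulVec x = 0) : coeffVec Q = 0 := by
  have h' : ∀ a b c d : ℂ, coeffVec Q ⬝ᵥ nu2four ![a, b, c, d] = 0 := fun a b c d => by
    rw [coeffVec_dot]; exact h _
  generalize coeffVec Q = v at h'
  simp [nu2four, dotProduct, Fin.sum_univ_succ] at h'
  have e0 := h' 1 0 0 0
  have e1 := h' 0 1 0 0
  have e2 := h' 0 0 1 0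
  have e3 := h' 0 0 0 1
  have e01 := h' 1 1 0 0
  have e02 := h' 1 0 1 0
  have e03 := h' 1 0 0 1
  have e12 := h' 0 1 1 0
  have e13 := h' 0 1 0 1
  have e23 := h' 0 0 1 1
  simp at e0 e1 e2 e3
  simp [e0, e1, e2, e3] at e01 e02 e03 e12 e13 e23
  funext i
  fin_cases i <;> assumption

theorem exists_frame (π : Fin 4 → ℂ) (hπ : π ≠ 0) :
    ∃ A : Matrix (Fin 4) (Fin 4) ℂ, A.det ≠ 0 ∧ ∀ j, π ⬝ᵥ A j ≠ 0 := by
  obtain ⟨k, hk⟩ := Function.ne_iff.mp hπ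
  simp only [Pi.zero_apply] at hk
  refine ⟨1 + replicateCol Unit (fun j => if π j = 0 then (1 : ℂ) else 0) *
    replicateRow Unit (Pi.single k (1 : ℂ)), ?_, ?_⟩
  · rw [Matrix.det_one_add_replicateCol_mul_replicateRow]
    simp [hk]
  · intro j
    have : (1 + replicateCol Unit (fun j => if π j = 0 then (1 : ℂ) else 0) *
      replicateRow Unit (Pi.single k (1 : ℂ)) : Matrix (Fin 4) (Fin 4) ℂ) j =
      Pi.single j 1 + (if π j = 0 then (1 : ℂ) else 0) • Pi.single k 1 := by
      funext i
      by_cases h : π j = 0 <;>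
        simp [h, Matrix.mul_apply, Matrix.one_apply, Pi.single_apply, eq_comm]
    rw [this, dotProduct_add, dotProduct_smul]
    by_cases h : π j = 0 <;> simp [h, hk]

theorem conic_iff (L : Fin 6 → Matrix (Fin 4) (Fin 4) ℂ) (π : Fin 4 → ℂ)
    (hπ : π ≠ 0) (hL : ∀ i, π ⬝ᵥ (L i).mulVec π = 0)
    (A : Matrix (Fin 4) (Fin 4) ℂ) (hA : A.det ≠ 0) (hA' : ∀ j, π ⬝ᵥ A j ≠ 0) :
    MeetsInConic L π ↔ (Matrix.of fun r c : Fin 10 =>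
      Fin.append (fun i : Fin 6 => nu2four ((L i).mulVec π))
        (fun j : Fin 4 => nu2four (A j)) c r).det = 0 := by
  rw [← Matrix.exists_vecMul_eq_zero_iff]
  have hv : ∀ v : Fin 10 → ℂ, v ᵥ* (Matrix.of fun r c : Fin 10 =>
      Fin.append (fun i : Fin 6 => nu2four ((L i).mulVec π))
        (fun j : Fin 4 => nu2four (A j)) c r) = 0 ↔
      (∀ i, v ⬝ᵥ nu2four ((L i).mulVec π) = 0) ∧ ∀ j, v ⬝ᵥ nu2four (A j) = 0 := by
    intro v
    constructor
    · intro h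
      refine ⟨fun i => ?_, fun j => ?_⟩
      · have := congrFun h (Fin.castAdd 4 i)
        rw [← Fin.append_left (fun i : Fin 6 => nu2four ((L i).mulVec π))
          (fun j : Fin 4 => nu2four (A j)) i]
        exact this
      · have := congrFun h (Fin.natAdd 6 j)
        rw [← Fin.append_right (fun i : Fin 6 => nu2four ((L i).mulVec π))
          (fun j : Fin 4 => nu2four (A j)) j]
        exact this
    · rintro ⟨h1, h2⟩
      funext c
      change v ⬝ᵥ (Fin.append (fun i : Fin 6 => nu2four ((L i).mulVec π))
        (fun j : Fin 4 => nu2four (A j)) c) = 0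
      refine Fin.addCases (m := 6) (n := 4) (fun i => ?_) (fun j => ?_) c
      · rw [Fin.append_left]; exact h1 i
      · rw [Fin.append_right]; exact h2 j
  simp only [hv]
  have quad_add : ∀ (Q : Matrix (Fin 4) (Fin 4) ℂ) (l x : Fin 4 → ℂ),
      x ⬝ᵥ (Q + vecMulVec π l).mulVec x = x ⬝ᵥ Q.mulVec x + (π ⬝ᵥ x) * (l ⬝ᵥ x) := by
    intro Q l x
    simp [Matrix.mulVec, dotProduct, Fin.sum_univ_four, vecMulVec_apply]
    ring
  constructor
  · rintro ⟨Q, -, hQ, hQL⟩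
    let w : Fin 4 → ℂ := fun j => - (A j ⬝ᵥ Q.mulVec (A j)) / (π ⬝ᵥ A j)
    have hw : A *ᵥ (A⁻¹ *ᵥ w) = w := by
      rw [Matrix.mulVec_mulVec, Matrix.mul_nonsing_inv _ (isUnit_iff_ne_zero.mpr hA),
        Matrix.one_mulVec]
    set l := A⁻¹ *ᵥ w
    refine ⟨coeffVec (Q + vecMulVec π l), ?_, ?_, ?_⟩
    · intro h0
      apply hQ
      intro x hx
      have h1 := quad_add Q l x
      rw [← coeffVec_dot, h0, hx] at h1
      simpa using h1.symm
    · intro i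
      rw [coeffVec_dot, quad_add, hL, hQL]; simp
    · intro j
      rw [coeffVec_dot, quad_add]
      have : l ⬝ᵥ A j = w j := by rw [dotProduct_comm]; exact congrFun hw j
      rw [this]
      have := hA' j
      simp only [w]
      field_simp
      ring
  · rintro ⟨v, hv0, h1, h2⟩
    rw [← coeffVec_symMat v] at hv0 h1 h2
    have hsym := symMat_symm v
    set Q := symMat v
    simp only [coeffVec_dot] at h1 h2
    refine ⟨Q, hsym, ?_, h1⟩
    intro hvan
    apply hv0
    apply coeffVec_zero_of
    obtain ⟨k, hk⟩ := Function.ne_iff.mp hπ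
    simp only [Pi.zero_apply] at hk
    obtain ⟨p, hp⟩ : ∃ p : Fin 4 → ℂ, π ⬝ᵥ p = 1 := ⟨Pi.single k (π k)⁻¹, by simp [hk]⟩
    set l : Fin 4 → ℂ := (2 : ℂ) • Q.mulVec p - (p ⬝ᵥ Q.mulVec p) • π with hl
    have hq : ∀ x, x ⬝ᵥ Q.mulVec x = (π ⬝ᵥ x) * (l ⬝ᵥ x) := by
      intro x
      have h := hvan (x - (π ⬝ᵥ x) • p) (by rw [dotProduct_sub, dotProduct_smul, hp]; simp)
      have hs : p ⬝ᵥ Q.mulVec x = x ⬝ᵥ Q.mulVec p := by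
        rw [Matrix.dotProduct_mulVec, ← Matrix.mulVec_transpose, hsym, dotProduct_comm]
      have hs' : Q.mulVec p ⬝ᵥ x = x ⬝ᵥ Q.mulVec p := dotProduct_comm _ _
      simp only [Matrix.mulVec_sub, Matrix.mulVec_smul, dotProduct_sub, sub_dotProduct,
        dotProduct_smul, smul_dotProduct, hs, smul_eq_mul] at h
      simp only [hl, sub_dotProduct, smul_dotProduct, hs', smul_eq_mul]
      linear_combination h
    have hl0 : l = 0 := by
      apply Matrix.eq_zero_of_mulVec_eq_zero hA
      funext j
      have := hq (A j)
      rw [h2 j] at this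
      have h3 := (mul_eq_zero.mp this.symm).resolve_left (hA' j)
      rw [dotProduct_comm] at h3
      exact h3
    intro x
    rw [hq, hl0]; simp

/-- (Result 2.)  There is a polynomial F(π), homogeneous of degree 8 in the
coordinates of π and independent of the points aⱼ, such that
D(π,a₁,…,a₄) = det(a₁,…,a₄)·(πᵀa₁)(πᵀa₂)(πᵀa₃)(πᵀa₄)·F(π);
moreover the planes meeting the six lines in points of a conic are exactly
the zeros of F. -/
theorem stmt16 (L : Fin 6 → Matrix (Fin 4) (Fin 4) ℂ)
    (hL : ∀ i, (L i)ᵀ = -(L i) ∧ (L i).rank = 2) :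
    ∃ F : MvPolynomial (Fin 4) ℂ, F.IsHomogeneous 8 ∧
      Dpoly L = Matrix.det (Matrix.of fun i j : Fin 4 => aVar j i)
          * (∏ j : Fin 4, ∑ i : Fin 4, piVar i * aVar j i)
          * MvPolynomial.rename Sum.inl F ∧
      ∀ π : Fin 4 → ℂ, (∀ i, (L i).mulVec π ≠ 0) →
        (MeetsInConic L π ↔ MvPolynomial.eval π F = 0) := by
  have hL1 : ∀ i, (L i)ᵀ = -(L i) := fun i => (hL i).1
  obtain ⟨F, hF8, hF⟩ := detG_factor L hL1
  have hD := Dpoly_factor L hL1 F hF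
  refine ⟨F, hF8, hD, fun π hne => ?_⟩
  have hπ : π ≠ 0 := by
    rintro rfl
    exact hne 0 (Matrix.mulVec_zero _)
  obtain ⟨A, hA, hA'⟩ := exists_frame π hπ
  rw [conic_iff L π hπ (fun i => antisymm_dot (L i) (hL1 i) (RingHom.id ℂ) π) A hA hA',
    eval_D L F hD]
  simp [hA, Finset.prod_eq_zero_iff, hA']
end
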